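/- Crossing gadget: There is a universal constant c₀ > 0 with the following property. Let R be a register of qubits, H_else Hermitian on R, let P_A, P_B, P_C, P_D be Hermitian involutions (P² = I) acting on four distinct qubits of R, and let α_ad, α_bc be real numbers. Adjoin one ancilla qubit t and define H₀ := |1⟩⟨1|_t, H₁ := H_else + (1/2)(α_ad² + α_bc² + 2)·I + α_ad·α_bc·P_A·P_B − α_ad·P_A·P_C − α_bc·P_B·P_D + P_C·P_D, and H₂ := (1/√2)(−α_ad·P_A − α_bc·P_B + P_C + P_D)⊗X_t. Then for all ε, η ∈ (0,1] and all Δ ≥ c₀(Λ⁶/ε² + Λ²/η²), where Λ := max(‖H₁‖, ‖H₂‖, 1), the Hamiltonian H̃ := Δ·H₀ + H₁ + √Δ·H₂ is a (Δ/2, η, ε)-simulation of the 'crossed' Hamiltonian H_target := H_else + α_ad·P_A·P_D + α_bc·P_B·P_C with product encoding, with ancilla state |anc⟩ = |0⟩_t; all two-body terms of H̃ act on the pairs {A,B}, {A,C}, {B,D}, {C,D}, or on a qubit together with the ancilla t. -/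

import Mathlib

open Matrix
open scoped Kronecker ComplexOrder

namespace QSim

/-- Index set for the computational basis of `n` qubits. -/
abbrev QIdx (n : ℕ) := Fin n → Fin 2

/-- Operators (matrices) on the Hilbert space of `n` qubits. -/
abbrev QOp (n : ℕ) := Matrix (QIdx n) (QIdx n) ℂ

/-- The operator (`ℓ²→ℓ²`) norm of a (possibly rectangular) matrix. -/
noncomputable def opNorm {I J : Type*} [Fintype I] [Fintype J] [DecidableEq J]
    (M : Matrix I J ℂ) : ℝ :=
  ‖LinearMap.toContinuousLinearMap (Matrix.toEuclideanLin M)‖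

/-- A two-qubit operator `E` placed on qubits `i` and `j` of an `n`-qubit register
(identity elsewhere), given entrywise. -/
def twoQubitOp (n : ℕ) (i j : Fin n) (E : Fin 2 → Fin 2 → Fin 2 → Fin 2 → ℂ) : QOp n :=
  fun x y => E (x i) (x j) (y i) (y j) * (if ∀ k, k ≠ i → k ≠ j → x k = y k then 1 else 0)

/-- A single-qubit operator `E` placed on qubit `i` of an `n`-qubit register. -/
def oneQubitOp (n : ℕ) (i : Fin n) (E : Matrix (Fin 2) (Fin 2) ℂ) : QOp n :=
  fun x y => E (x i) (y i) * (if ∀ k, k ≠ i → x k = y k then 1 else 0)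

/-- Sign used to build `(|01⟩ - |10⟩)/√2`. -/
def sgnE (a b : Fin 2) : ℂ :=
  if a = 0 ∧ b = 1 then 1 else if a = 1 ∧ b = 0 then -1 else 0

/-- Entries of the two-qubit projector `P` onto `span{(|01⟩-|10⟩)/√2, |11⟩}`:
`P = (1/2)(|01⟩-|10⟩)(⟨01|-⟨10|) + |11⟩⟨11|`. -/
noncomputable def Pentry (a b c d : Fin 2) : ℂ :=
  (1 / 2) * sgnE a b * sgnE c d + (if a = 1 ∧ b = 1 ∧ c = 1 ∧ d = 1 then 1 else 0)

/-- `H_{W,0} = Σ_{i=1}^{n-1} P_{i,i+1}`. -/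
noncomputable def HW0 (n : ℕ) : QOp n :=
  ∑ i : Fin (n - 1),
    twoQubitOp n ⟨i.1, by have := i.2; omega⟩ ⟨i.1 + 1, by have := i.2; omega⟩ Pentry

/-- The all-zeros state `|0…0⟩`. -/
def ket0 (n : ℕ) : QIdx n → ℂ := fun x => if ∀ k, x k = 0 then 1 else 0

/-- The generalized W state `|W_n⟩ = n^{-1/2} Σ_i |e_i⟩`. -/
noncomputable def Wstate (n : ℕ) : QIdx n → ℂ := fun x =>
  if (Finset.univ.filter fun k => x k = 1).card = 1 then (((Real.sqrt n)⁻¹ : ℝ) : ℂ) else 0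

end QSim

namespace QSim

/-- The Pauli `Z` matrix. -/
noncomputable def Zmat : Matrix (Fin 2) (Fin 2) ℂ := !![1, 0; 0, -1]

/-- The Pauli `X` matrix. -/
noncomputable def Xmat : Matrix (Fin 2) (Fin 2) ℂ := !![0, 1; 1, 0]

/-- The W-state parent Hamiltonian `H_W = Γ·H_{W,0} + 1 - Σ_{i=1}^n (1 - Z_i)/2`. -/
noncomputable def HWham (n : ℕ) (Γ : ℝ) : QOp n :=
  (Γ : ℂ) • HW0 n + 1 - ∑ i : Fin n, oneQubitOp n i ((1 - Zmat) / 2)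

end QSim

namespace QSim

open scoped Classical in
/-- The spectral projector of a Hermitian matrix onto the span of its eigenvectors with
eigenvalue strictly below `Δ` (junk value `0` if the matrix is not Hermitian). -/
noncomputable def specProjBelow {I : Type*} [Fintype I] [DecidableEq I]
    (M : Matrix I I ℂ) (Δ : ℝ) : Matrix I I ℂ :=
  if hM : M.IsHermitian then
    (hM.eigenvectorUnitary : Matrix I I ℂ) *
      Matrix.diagonal (fun k => if hM.eigenvalues k < Δ then (1 : ℂ) else 0) *
      (hM.eigenvectorUnitary : Matrix I I ℂ)ᴴ
  else 0

/-- The isometry `T : ψ ↦ ψ ⊗ |anc⟩` from `ℋ` into `ℋ⊗𝒜`, as a rectangular matrix. -/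
def prodIso {I J : Type*} [DecidableEq I] (anc : J → ℂ) : Matrix (I × J) I ℂ :=
  fun p i => if p.1 = i then anc p.2 else 0

/-- `H_s` (on `ℋ⊗𝒜`) is a `(Δ,η,ε)`-simulation of `H_t` (on `ℋ`) with product encoding,
witnessed by the isometry `T̃`: `|anc⟩` is a unit vector, `T̃` is an isometry with range the
eigenspace of `H_s` of energies `< Δ`, `‖T̃ - (·⊗|anc⟩)‖ ≤ η`, and
`‖P H_s P - T̃ H_t T̃†‖ ≤ ε` where `P` is the spectral projector below `Δ`. -/
noncomputable def IsSimulationWith {I J : Type*} [Fintype I] [DecidableEq I]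
    [Fintype J] [DecidableEq J]
    (Hs : Matrix (I × J) (I × J) ℂ) (Ht : Matrix I I ℂ) (anc : J → ℂ)
    (Tt : Matrix (I × J) I ℂ) (Δ η ε : ℝ) : Prop :=
  star anc ⬝ᵥ anc = 1 ∧
  Ttᴴ * Tt = 1 ∧
  Tt * Ttᴴ = specProjBelow Hs Δ ∧
  opNorm (Tt - prodIso anc) ≤ η ∧
  opNorm (specProjBelow Hs Δ * Hs * specProjBelow Hs Δ - Tt * Ht * Ttᴴ) ≤ ε

/-- `H_s` is a `(Δ,η,ε)`-simulation of `H_t` with product encoding (ancilla state `anc`). -/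
noncomputable def IsSimulation {I J : Type*} [Fintype I] [DecidableEq I]
    [Fintype J] [DecidableEq J]
    (Hs : Matrix (I × J) (I × J) ℂ) (Ht : Matrix I I ℂ) (anc : J → ℂ) (Δ η ε : ℝ) : Prop :=
  ∃ Tt : Matrix (I × J) I ℂ, IsSimulationWith Hs Ht anc Tt Δ η ε

end QSim

namespace QSim

/-- `M` acts nontrivially only on the qubits in `S` (i.e. `M = M_S ⊗ I` on the rest). -/
def ActsOn {ι : Type*} [Fintype ι] [DecidableEq ι]
    (M : Matrix (ι → Fin 2) (ι → Fin 2) ℂ) (S : Finset ι) : Prop :=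
  ∃ f : ({k // k ∈ S} → Fin 2) → ({k // k ∈ S} → Fin 2) → ℂ,
    ∀ x y, M x y
      = (if ∀ k ∉ S, x k = y k then 1 else 0) * f (fun k => x k.1) (fun k => y k.1)

/-- The projector `|0⟩⟨0|` on one qubit. -/
noncomputable def proj0 : Matrix (Fin 2) (Fin 2) ℂ := !![1, 0; 0, 0]

/-- The projector `|1⟩⟨1|` on one qubit. -/
noncomputable def proj1 : Matrix (Fin 2) (Fin 2) ℂ := !![0, 0; 0, 1]

/-- The state `|0⟩` of the ancilla qubit. -/
def anc0 : Fin 2 → ℂ := fun t => if t = 0 then 1 else 0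

end QSim

namespace QSim

open scoped Matrix.Norms.L2Operator

theorem exists_inv_sqrt {A : Type*} [CStarAlgebra A] [Nontrivial A] (x : A) :
    ∃ r : A, star r = r ∧ r * (1 + star x * x) * r = 1 ∧ ‖r‖ ≤ 1 ∧ ‖r - 1‖ ≤ ‖star x * x‖ := by
  set a := star x * x with ha
  have hsa : IsSelfAdjoint a := IsSelfAdjoint.star_mul_self x
  have hsp : ∀ t ∈ spectrum ℝ a, 0 ≤ t ∧ t ≤ ‖a‖ := fun t ht =>
    ⟨spectrum_star_mul_self_nonneg t ht, (le_abs_self t).trans (spectrum.norm_le_norm_of_mem ht)⟩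
  have hc : ContinuousOn (fun t : ℝ => (√(1 + t))⁻¹) (spectrum ℝ a) := by
    refine ContinuousOn.inv₀ (by fun_prop) fun t ht => ?_
    have := (hsp t ht).1
    positivity
  have hc1 : ContinuousOn (fun t : ℝ => 1 + t) (spectrum ℝ a) := by fun_prop
  refine ⟨cfc (fun t : ℝ => (√(1 + t))⁻¹) a,
    (cfc_predicate _ a : IsSelfAdjoint (cfc (fun t : ℝ => (√(1 + t))⁻¹) a)).star_eq, ?_, ?_, ?_⟩
  · have h1 : 1 + a = cfc (fun t : ℝ => 1 + t) a := by
      rw [cfc_const_add (1 : ℝ) (fun t => t) a, cfc_id' ℝ a, map_one]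
    rw [h1, ← cfc_mul _ _ a hc hc1, ← cfc_mul (fun t : ℝ => (√(1 + t))⁻¹ * (1 + t)) _ a (hc.mul hc1) hc, ← cfc_const_one ℝ a]
    refine cfc_congr fun t ht => ?_
    have := (hsp t ht).1
    have h2 := Real.mul_self_sqrt (show 0 ≤ 1 + t by linarith)
    have h3 : √(1 + t) ≠ 0 := by positivity
    field_simp
    nlinarith
  · refine norm_cfc_le zero_le_one fun t ht => ?_
    have := (hsp t ht).1
    rw [Real.norm_of_nonneg (by positivity)]
    exact inv_le_one_of_one_le₀ (Real.one_le_sqrt.2 (by linarith))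
  · have h1 : cfc (fun t : ℝ => (√(1 + t))⁻¹) a - 1 = cfc (fun t : ℝ => (√(1 + t))⁻¹ - 1) a := by
      rw [cfc_sub _ _ a hc (by fun_prop), cfc_const_one ℝ a]
    rw [h1]
    refine norm_cfc_le (norm_nonneg _) fun t ht => ?_
    obtain ⟨h0, h2⟩ := hsp t ht
    have h3 : 1 ≤ √(1 + t) := Real.one_le_sqrt.2 (by linarith)
    have h4 : √(1 + t) ≤ 1 + t := Real.sqrt_le_iff.2 ⟨by linarith, by nlinarith⟩
    have h5 := inv_le_one_of_one_le₀ h3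
    have h6 : 1 - t ≤ (√(1 + t))⁻¹ := by
      have : (1 + t)⁻¹ ≤ (√(1 + t))⁻¹ := by gcongr
      refine le_trans ?_ this
      rw [← one_div, le_div_iff₀ (by linarith)]
      nlinarith
    rw [Real.norm_eq_abs, abs_le]
    constructor <;> linarith

theorem norm_mul_le_of_le' {A : Type*} [NormedRing A] {a b : A} {p q : ℝ}
    (ha : ‖a‖ ≤ p) (hb : ‖b‖ ≤ q) : ‖a * b‖ ≤ p * q :=
  (norm_mul_le a b).trans (mul_le_mul ha hb (norm_nonneg _) ((norm_nonneg _).trans ha))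

/-- Solution of the Riccati equation which block diagonalizes a `2 × 2` block operator. -/
theorem exists_riccati {A : Type*} [NormedRing A] [NormedAlgebra ℂ A] [CompleteSpace A]
    (h b : A) (t l : ℝ) (ht : 0 ≤ t) (hl : 1 ≤ l) (hh : ‖h‖ ≤ l) (hb : ‖b‖ ≤ l)
    (hlt : 12 * l ^ 2 * t ≤ 1) :
    ∃ y : A, ‖y‖ ≤ 2 * l ∧ y = -b + (t : ℂ) • (y * h + y * b * y - h * y) := by
  have hnt (z : A) : ‖(t : ℂ) • z‖ = t * ‖z‖ := by
    rw [norm_smul, Complex.norm_real, Real.norm_of_nonneg ht]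
  have hlt1 : l * t ≤ l ^ 2 * t := by nlinarith [mul_nonneg ht (sub_nonneg.2 hl)]
  have hl0 : 0 ≤ l := by linarith
  let f : A → A := fun y => -b + (t : ℂ) • (y * h + y * b * y - h * y)
  have hmaps : Set.MapsTo f (Metric.closedBall 0 (2 * l)) (Metric.closedBall 0 (2 * l)) := by
    intro y hy
    rw [mem_closedBall_zero_iff] at hy ⊢
    have h1 : ‖y * h + y * b * y - h * y‖ ≤ 2 * l * l + 2 * l * l * (2 * l) + l * (2 * l) :=
      (norm_sub_le _ _).trans (add_le_add ((norm_add_le _ _).trans (add_le_add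
        (norm_mul_le_of_le' hy hh) (norm_mul_le_of_le' (norm_mul_le_of_le' hy hb) hy)))
        (norm_mul_le_of_le' hh hy))
    calc ‖f y‖ ≤ ‖b‖ + t * ‖y * h + y * b * y - h * y‖ := by
          simpa only [norm_neg, hnt] using norm_add_le (-b) ((t : ℂ) • (y * h + y * b * y - h * y))
      _ ≤ l + t * (2 * l * l + 2 * l * l * (2 * l) + l * (2 * l)) := by gcongr
      _ ≤ 2 * l := by nlinarith
  have hlip : LipschitzOnWith (1 / 2) f (Metric.closedBall 0 (2 * l)) := by
    refine LipschitzOnWith.of_dist_le_mul fun y hy z hz => ?_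
    rw [mem_closedBall_zero_iff] at hy hz
    rw [dist_eq_norm, dist_eq_norm]
    have h0 : f y - f z =
        (t : ℂ) • ((y - z) * h + ((y - z) * (b * y) + z * b * (y - z)) - h * (y - z)) := by
      simp only [f]
      rw [add_sub_add_left_eq_sub, ← smul_sub]
      congr 1
      noncomm_ring
    have h1 : ‖(y - z) * h + ((y - z) * (b * y) + z * b * (y - z)) - h * (y - z)‖ ≤
        ‖y - z‖ * l + (‖y - z‖ * (l * (2 * l)) + 2 * l * l * ‖y - z‖) + l * ‖y - z‖ :=
      (norm_sub_le _ _).trans (add_le_add ((norm_add_le _ _).trans (add_le_add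
        (norm_mul_le_of_le' le_rfl hh) ((norm_add_le _ _).trans (add_le_add
        (norm_mul_le_of_le' le_rfl (norm_mul_le_of_le' hb hy))
        (norm_mul_le_of_le' (norm_mul_le_of_le' hz hb) le_rfl)))))
        (norm_mul_le_of_le' hh le_rfl))
    rw [h0, hnt]
    calc _ ≤ t * (‖y - z‖ * l + (‖y - z‖ * (l * (2 * l)) + 2 * l * l * ‖y - z‖)
            + l * ‖y - z‖) := by gcongr
      _ = (2 * (l * t) + 4 * (l ^ 2 * t)) * ‖y - z‖ := by ring
      _ ≤ 1 / 2 * ‖y - z‖ := by gcongr; linarith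
      _ = _ := by norm_num
  have hcontr : ContractingWith (1 / 2) (hmaps.restrict f _ _) :=
    ⟨by rw [← NNReal.coe_lt_coe]; norm_num, hlip.mapsToRestrict hmaps⟩
  obtain ⟨y, hy, hfix, -⟩ := hcontr.exists_fixedPoint' Metric.isClosed_closedBall.isComplete hmaps
    (Metric.mem_closedBall_self (by positivity)) (edist_ne_top 0 _)
  exact ⟨y, mem_closedBall_zero_iff.1 hy, hfix.symm⟩

theorem eq_zero_of_mulVec_eq_smul {n : Type*} [Fintype n] [DecidableEq n] (K : Matrix n n ℂ)
    (v : n → ℂ) (μ : ℝ) (h : K *ᵥ v = (μ : ℂ) • v) (hK : ‖K‖ < μ) : v = 0 := by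
  have h1 := Matrix.l2_opNorm_mulVec K (WithLp.toLp 2 v)
  have h2 : (EuclideanSpace.equiv n ℂ).symm (K *ᵥ v) = (μ : ℂ) • WithLp.toLp 2 v := by
    rw [h]; rfl
  rw [h2, norm_smul, Complex.norm_real, Real.norm_eq_abs] at h1
  by_contra hv
  have h3 : 0 < ‖WithLp.toLp 2 v‖ := norm_pos_iff.2 (by simpa using hv)
  have := le_of_mul_le_mul_right h1 h3
  linarith [le_abs_self μ]

theorem eq_specProjBelow {N : Type*} [Fintype N] [DecidableEq N] {M Q : Matrix N N ℂ} {δ : ℝ}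
    (hM : M.IsHermitian)
    (hlow : ∀ (μ : ℝ) (v : N → ℂ), M *ᵥ v = (μ : ℂ) • v → μ < δ → Q *ᵥ v = v)
    (hhigh : ∀ (μ : ℝ) (v : N → ℂ), M *ᵥ v = (μ : ℂ) • v → δ ≤ μ → Q *ᵥ v = 0) :
    Q = specProjBelow M δ := by
  classical
  have key : Q * (hM.eigenvectorUnitary : Matrix N N ℂ) = (hM.eigenvectorUnitary : Matrix N N ℂ) *
      Matrix.diagonal (fun k => if hM.eigenvalues k < δ then (1 : ℂ) else 0) := by
    ext i k
    have hv : M *ᵥ (hM.eigenvectorBasis k).ofLp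
        = (hM.eigenvalues k : ℂ) • (hM.eigenvectorBasis k).ofLp := by
      rw [hM.mulVec_eigenvectorBasis]; rfl
    have h1 : (Q * (hM.eigenvectorUnitary : Matrix N N ℂ)) i k
        = (Q *ᵥ (hM.eigenvectorBasis k).ofLp) i := rfl
    rw [h1, Matrix.mul_diagonal, Matrix.IsHermitian.eigenvectorUnitary_apply]
    split_ifs with hk
    · rw [hlow _ _ hv hk, mul_one]
    · rw [hhigh _ _ hv (not_lt.1 hk), mul_zero]; rfl
  have hU : (hM.eigenvectorUnitary : Matrix N N ℂ) * (hM.eigenvectorUnitary : Matrix N N ℂ)ᴴ = 1 :=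
    Unitary.mul_star_self_of_mem hM.eigenvectorUnitary.2
  rw [specProjBelow, dif_pos hM]
  calc Q = Q * ((hM.eigenvectorUnitary : Matrix N N ℂ)
        * (hM.eigenvectorUnitary : Matrix N N ℂ)ᴴ) := by rw [hU, Matrix.mul_one]
    _ = _ := by
      rw [← Matrix.mul_assoc, key]


theorem l2_opNorm_le_one_of_isometry {N n : Type*} [Fintype N] [DecidableEq N] [Fintype n]
    [DecidableEq n] [Nonempty n] {T : Matrix N n ℂ} (hT : Tᴴ * T = 1) : ‖T‖ ≤ 1 := by
  have h := Matrix.l2_opNorm_conjTranspose_mul_self T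
  rw [hT, norm_one] at h
  nlinarith [norm_nonneg T]

theorem l2_opNorm_mul_le_of_le {k m n : Type*} [Fintype k] [Fintype m] [Fintype n]
    [DecidableEq m] [DecidableEq n] {a : Matrix k m ℂ} {b : Matrix m n ℂ} {p q : ℝ}
    (ha : ‖a‖ ≤ p) (hb : ‖b‖ ≤ q) : ‖a * b‖ ≤ p * q :=
  (Matrix.l2_opNorm_mul a b).trans (mul_le_mul ha hb (norm_nonneg _) ((norm_nonneg _).trans ha))

/-- Eigenvectors of low energy have trivial component along the complement of a graph subspace. -/
theorem eq_zero_of_low_eigenvector {N n : Type*} [Fintype N] [DecidableEq N] [Fintype n]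
    [DecidableEq n] {e₀ e₁ : Matrix N n ℂ} {M : Matrix N N ℂ} {H B z : Matrix n n ℂ}
    {s l μ : ℝ} {w : N → ℂ} (hsum : e₀ * e₀ᴴ + e₁ * e₁ᴴ = 1) (hM : Mᴴ = M) (hH : Hᴴ = H)
    (hB : Bᴴ = B) (hM1 : M * e₁ = (s : ℂ) • (e₀ * B) + ((s : ℂ) ^ 2 • e₁ + e₁ * H))
    (hMw : M *ᵥ w = (μ : ℂ) • w) (hab : e₀ᴴ *ᵥ w = -(z *ᵥ (e₁ᴴ *ᵥ w)))
    (hz : ‖(s : ℂ) • z‖ ≤ 2 * l) (hHl : ‖H‖ ≤ l) (hBl : ‖B‖ ≤ l)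
    (hμ : l * (2 * l) + l < s ^ 2 - μ) : w = 0 := by
  set a := e₀ᴴ *ᵥ w with ha
  set b := e₁ᴴ *ᵥ w with hb
  have h1 : e₁ᴴ * M = (s : ℂ) • (B * e₀ᴴ) + ((s : ℂ) ^ 2 • e₁ᴴ + H * e₁ᴴ) := by
    have := congrArg Matrix.conjTranspose hM1
    simpa [Matrix.conjTranspose_mul, hM, hB, hH] using this
  have h2 : (e₁ᴴ * M) *ᵥ w = (μ : ℂ) • b := by
    rw [← Matrix.mulVec_mulVec, hMw, Matrix.mulVec_smul]
  have h3 : (μ : ℂ) • b = (s : ℂ) • (B *ᵥ a) + ((s : ℂ) ^ 2 • b + H *ᵥ b) := by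
    rw [← h2, h1, Matrix.add_mulVec, Matrix.add_mulVec, Matrix.smul_mulVec, Matrix.smul_mulVec,
      ← Matrix.mulVec_mulVec, ← Matrix.mulVec_mulVec]
  have hb0 : b = 0 := by
    refine eq_zero_of_mulVec_eq_smul (B * ((s : ℂ) • z) - H) b (s ^ 2 - μ) ?_ ?_
    · push_cast
      rw [sub_smul, h3, hab, Matrix.sub_mulVec, ← Matrix.mulVec_mulVec, Matrix.smul_mulVec,
        Matrix.mulVec_smul, Matrix.mulVec_neg, smul_neg]
      abel
    · exact ((norm_sub_le _ _).trans (add_le_add (norm_mul_le_of_le' hBl hz) hHl)).trans_lt hμ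
  calc w = (e₀ * e₀ᴴ + e₁ * e₁ᴴ) *ᵥ w := by rw [hsum, Matrix.one_mulVec]
    _ = e₀ *ᵥ a + e₁ *ᵥ b := by
      rw [Matrix.add_mulVec, ← Matrix.mulVec_mulVec, ← Matrix.mulVec_mulVec]
    _ = 0 := by simp [hab, hb0]

set_option maxHeartbeats 800000 in
/-- Exact block diagonalization of a Hermitian `M` which, with respect to the decomposition given
by the isometries `e₀` and `e₁`, has the block form `!![H, s B; s B, s² + H]`. -/
theorem exists_isometry_of_blocks {N n : Type*} [Fintype N] [DecidableEq N] [Fintype n]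
    [DecidableEq n] [Nonempty n] {e₀ e₁ : Matrix N n ℂ} {M : Matrix N N ℂ} {H B : Matrix n n ℂ}
    {s l : ℝ} (h00 : e₀ᴴ * e₀ = 1) (h11 : e₁ᴴ * e₁ = 1) (h01 : e₀ᴴ * e₁ = 0)
    (hsum : e₀ * e₀ᴴ + e₁ * e₁ᴴ = 1) (hM : Mᴴ = M) (hH : Hᴴ = H) (hB : Bᴴ = B)
    (hM0 : M * e₀ = e₀ * H + (s : ℂ) • (e₁ * B))
    (hM1 : M * e₁ = (s : ℂ) • (e₀ * B) + ((s : ℂ) ^ 2 • e₁ + e₁ * H))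
    (hl : 1 ≤ l) (hHl : ‖H‖ ≤ l) (hBl : ‖B‖ ≤ l) (hs : 0 < s) (hls : 16 * l ^ 2 ≤ s ^ 2) :
    ∃ T : Matrix N n ℂ, Tᴴ * T = 1 ∧ T * Tᴴ = specProjBelow M (s ^ 2 / 2) ∧
      ‖T - e₀‖ ≤ 4 * l ^ 2 / s ^ 2 + 2 * l / s ∧
      ‖specProjBelow M (s ^ 2 / 2) * M * specProjBelow M (s ^ 2 / 2) - T * (H - B * B) * Tᴴ‖
        ≤ 56 * l ^ 4 / s ^ 2 := by
  have h10 : e₁ᴴ * e₀ = 0 := by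
    have := congrArg Matrix.conjTranspose h01
    simpa using this
  have hl0 : 0 ≤ l := by linarith
  have hsC : (s : ℂ) ≠ 0 := by exact_mod_cast hs.ne'
  obtain ⟨y, hy, hyeq⟩ := exists_riccati H B (s ^ 2)⁻¹ l (by positivity) hl hHl hBl (by
    rw [← div_eq_mul_inv, div_le_one (by positivity)]; nlinarith [sq_nonneg l])
  obtain ⟨x, hx⟩ : ∃ x : Matrix n n ℂ, x = (s : ℂ)⁻¹ • y := ⟨_, rfl⟩
  have hxy : (s : ℂ) • x = y := by rw [hx, smul_smul, mul_inv_cancel₀ hsC, one_smul]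
  have hxn : ‖x‖ ≤ 2 * l / s := by
    rw [hx, norm_smul, norm_inv, Complex.norm_real, Real.norm_of_nonneg hs.le, div_eq_inv_mul]
    gcongr
  have hyn : ‖B + y‖ ≤ 8 * l ^ 3 / s ^ 2 := by
    have h1 : B + y = (((s ^ 2)⁻¹ : ℝ) : ℂ) • (y * H + y * B * y - H * y) := by
      nth_rewrite 1 [hyeq]
      abel
    rw [h1, norm_smul, Complex.norm_real, Real.norm_of_nonneg (by positivity), div_eq_inv_mul]
    gcongr
    refine ((norm_sub_le _ _).trans (add_le_add ((norm_add_le _ _).trans (add_le_add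
        (norm_mul_le_of_le' hy hHl) (norm_mul_le_of_le' (norm_mul_le_of_le' hy hBl) hy)))
        (norm_mul_le_of_le' hHl hy))).trans ?_
    nlinarith [sq_nonneg l]
  obtain ⟨L, hL⟩ : ∃ L : Matrix n n ℂ, L = H + B * y := ⟨_, rfl⟩
  have hric : x * L = (s : ℂ) • B + (s : ℂ) ^ 2 • x + H * x := by
    have h1 : (s : ℂ) ^ 2 • y = -((s : ℂ) ^ 2 • B) + (y * H + y * B * y - H * y) := by
      nth_rewrite 1 [hyeq]
      rw [smul_add, smul_smul, smul_neg]
      push_cast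
      rw [mul_inv_cancel₀ (pow_ne_zero 2 hsC), one_smul]
    have h2 : y * L = (s : ℂ) ^ 2 • B + (s : ℂ) ^ 2 • y + H * y := by
      rw [h1, hL]; noncomm_ring
    rw [hx, Matrix.smul_mul, h2, smul_add, smul_add, smul_smul, smul_smul, Matrix.mul_smul,
      smul_smul]
    congr 3 <;> field_simp
  obtain ⟨S, hS⟩ : ∃ S : Matrix n n ℂ, S = 1 + xᴴ * x := ⟨_, rfl⟩
  obtain ⟨R, hRs, hRSR, hRn, hR1⟩ := exists_inv_sqrt x
  rw [Matrix.star_eq_conjTranspose] at hRs hRSR hR1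
  rw [← hS] at hRSR
  have hxx : ‖xᴴ * x‖ ≤ 4 * l ^ 2 / s ^ 2 := by
    rw [Matrix.l2_opNorm_conjTranspose_mul_self]
    calc ‖x‖ * ‖x‖ ≤ (2 * l / s) * (2 * l / s) := by gcongr
      _ = _ := by ring
  have hxx1 : 4 * l ^ 2 / s ^ 2 ≤ 1 / 4 := by
    rw [div_le_iff₀ (by positivity)]; linarith
  have hSn : ‖S‖ ≤ 2 := by
    rw [hS]
    refine (norm_add_le _ _).trans ?_
    rw [norm_one]; linarith
  have hRRS : R * R * S = 1 := by
    have h1 : S * R * R = 1 := mul_eq_one_comm.1 (by rw [← Matrix.mul_assoc, hRSR])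
    exact mul_eq_one_comm.1 (by rw [← Matrix.mul_assoc, h1])
  obtain ⟨E, hE⟩ : ∃ E : Matrix N n ℂ, E = e₀ + e₁ * x := ⟨_, rfl⟩
  have hEE : Eᴴ * E = S := by
    rw [hE, hS]
    simp only [Matrix.conjTranspose_add, Matrix.conjTranspose_mul, Matrix.add_mul, Matrix.mul_add,
      h00, ← Matrix.mul_assoc, h01]
    simp only [Matrix.mul_assoc, h10]
    simp only [← Matrix.mul_assoc e₁ᴴ, h11]
    simp
  have hME : M * E = E * L := by
    have h1 : E * L = e₀ * L + e₁ * (x * L) := by rw [hE, Matrix.add_mul, Matrix.mul_assoc]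
    rw [h1, hric, hE, Matrix.mul_add, ← Matrix.mul_assoc, hM0, hM1, hL, ← hxy]
    simp only [Matrix.mul_add, Matrix.add_mul, Matrix.mul_smul, Matrix.smul_mul, Matrix.mul_assoc]
    abel
  obtain ⟨T, hT⟩ : ∃ T : Matrix N n ℂ, T = E * R := ⟨_, rfl⟩
  have hTH : Tᴴ = R * Eᴴ := by rw [hT, Matrix.conjTranspose_mul, hRs]
  have hTT : Tᴴ * T = 1 := by
    rw [hTH, hT, ← hRSR, ← hEE]
    simp only [Matrix.mul_assoc]
  obtain ⟨K, hK⟩ : ∃ K : Matrix n n ℂ, K = R * S * L * R := ⟨_, rfl⟩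
  have hMT : M * T = T * K := by
    calc M * T = E * L * R := by rw [hT, ← Matrix.mul_assoc, hME]
      _ = E * ((R * R * S) * L * R) := by rw [hRRS, Matrix.one_mul, Matrix.mul_assoc]
      _ = T * K := by rw [hT, hK]; simp only [Matrix.mul_assoc]
  have hTMT : Tᴴ * M * T = K := by
    rw [Matrix.mul_assoc, hMT, ← Matrix.mul_assoc, hTT, Matrix.one_mul]
  have hKH : Kᴴ = K := by
    rw [← hTMT]
    simp only [Matrix.conjTranspose_mul, Matrix.conjTranspose_conjTranspose, hM, Matrix.mul_assoc]
  have hTM : Tᴴ * M = K * Tᴴ := by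
    have := congrArg Matrix.conjTranspose hMT
    rwa [Matrix.conjTranspose_mul, Matrix.conjTranspose_mul T, hM, hKH] at this
  have hll : l ≤ l ^ 2 := by nlinarith
  have hLn : ‖L‖ ≤ 3 * l ^ 2 := hL ▸
    (norm_add_le _ _).trans ((add_le_add hHl (norm_mul_le_of_le' hBl hy)).trans (by nlinarith))
  have hKn : ‖K‖ < s ^ 2 / 2 := by
    have : ‖K‖ ≤ 1 * 2 * (3 * l ^ 2) * 1 := hK ▸
      norm_mul_le_of_le' (norm_mul_le_of_le' (norm_mul_le_of_le' hRn hSn) hLn) hRn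
    nlinarith
  have hproj : T * Tᴴ = specProjBelow M (s ^ 2 / 2) := by
    refine eq_specProjBelow hM (fun μ v hv hμ => ?_) (fun μ v hv hμ => ?_)
    · set w := v - (T * Tᴴ) *ᵥ v with hw
      have hTw : Tᴴ *ᵥ w = 0 := by
        rw [hw, Matrix.mulVec_sub, Matrix.mulVec_mulVec, ← Matrix.mul_assoc, hTT, Matrix.one_mul,
          sub_self]
      have hMw : M *ᵥ w = (μ : ℂ) • w := by
        rw [hw, Matrix.mulVec_sub, Matrix.mulVec_mulVec, ← Matrix.mul_assoc, hMT, Matrix.mul_assoc,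
          ← hTM, ← Matrix.mul_assoc, ← Matrix.mulVec_mulVec, hv, Matrix.mulVec_smul, smul_sub]
      have hab : e₀ᴴ *ᵥ w = -(xᴴ *ᵥ (e₁ᴴ *ᵥ w)) := by
        have h1 : Eᴴ *ᵥ w = 0 := by
          have h2 : S * R * R = 1 := by rw [Matrix.mul_assoc, mul_eq_one_comm.1 hRRS]
          calc Eᴴ *ᵥ w = (S * R * (R * Eᴴ)) *ᵥ w := by
                rw [← Matrix.mul_assoc, h2, Matrix.one_mul]
            _ = 0 := by rw [← hTH, ← Matrix.mulVec_mulVec, hTw, Matrix.mulVec_zero]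
        rw [hE, Matrix.conjTranspose_add, Matrix.conjTranspose_mul, Matrix.add_mulVec,
          ← Matrix.mulVec_mulVec] at h1
        exact eq_neg_of_add_eq_zero_left h1
      have hyH : ‖(s : ℂ) • xᴴ‖ ≤ 2 * l := by
        have h1 : (s : ℂ) • xᴴ = yᴴ := by
          rw [← hxy, Matrix.conjTranspose_smul, RCLike.star_def, Complex.conj_ofReal]
        rwa [h1, Matrix.l2_opNorm_conjTranspose]
      have hw0 : w = 0 := eq_zero_of_low_eigenvector hsum hM hH hB hM1 hMw hab hyH hHl hBl
        (by nlinarith)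
      exact (sub_eq_zero.1 hw0).symm
    · have h1 : K *ᵥ (Tᴴ *ᵥ v) = (μ : ℂ) • (Tᴴ *ᵥ v) := by
        rw [Matrix.mulVec_mulVec, ← hTM, ← Matrix.mulVec_mulVec, hv, Matrix.mulVec_smul]
      rw [← Matrix.mulVec_mulVec,
        eq_zero_of_mulVec_eq_smul K _ μ h1 (hKn.trans_le hμ), Matrix.mulVec_zero]
  have hTn : ‖T‖ ≤ 1 := l2_opNorm_le_one_of_isometry hTT
  refine ⟨T, hTT, hproj, ?_, ?_⟩
  · have h1 : T - e₀ = e₀ * (R - 1) + e₁ * (x * R) := by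
      rw [hT, hE, Matrix.add_mul, Matrix.mul_sub, Matrix.mul_one, Matrix.mul_assoc]
      abel
    rw [h1]
    refine (norm_add_le _ _).trans (add_le_add ?_ ?_)
    · simpa using l2_opNorm_mul_le_of_le (l2_opNorm_le_one_of_isometry h00) (hR1.trans hxx)
    · simpa using l2_opNorm_mul_le_of_le (l2_opNorm_le_one_of_isometry h11)
        (norm_mul_le_of_le' hxn hRn)
  · have h1 : specProjBelow M (s ^ 2 / 2) * M * specProjBelow M (s ^ 2 / 2)
        - T * (H - B * B) * Tᴴ = T * (K - (H - B * B)) * Tᴴ := by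
      rw [← hproj, ← hTMT]
      simp only [Matrix.mul_sub, Matrix.sub_mul, Matrix.mul_assoc]
    have hRSRL : K - (H - B * B) = R * S * (L * (R - 1) - (R - 1) * L) + B * (B + y) := by
      calc K - (H - B * B) = R * S * L * R - (R * S * R) * L + B * (B + y) := by
            rw [hRSR, hK, hL]; noncomm_ring
        _ = _ := by noncomm_ring
    have h2 : ‖K - (H - B * B)‖ ≤ 56 * l ^ 4 / s ^ 2 := by
      have hRn1 := hR1.trans hxx
      rw [hRSRL]
      refine ((norm_add_le _ _).trans (add_le_add (norm_mul_le_of_le' (norm_mul_le_of_le' hRn hSn)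
        ((norm_sub_le _ _).trans (add_le_add (norm_mul_le_of_le' hLn hRn1)
        (norm_mul_le_of_le' hRn1 hLn)))) (norm_mul_le_of_le' hBl hyn))).trans (le_of_eq ?_)
      ring
    rw [h1]
    have hTHn : ‖Tᴴ‖ ≤ 1 := by rwa [Matrix.l2_opNorm_conjTranspose]
    simpa using l2_opNorm_mul_le_of_le (l2_opNorm_mul_le_of_le hTn h2) hTHn

theorem oneQubitOp_mul_apply (m : ℕ) (i : Fin m) (p : Matrix (Fin 2) (Fin 2) ℂ) (A : QOp m)
    (x y : QIdx m) :
    (oneQubitOp m i p * A) x y = ∑ a, p (x i) a * A (Function.update x i a) y := by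
  classical
  rw [Matrix.mul_apply]
  refine (Finset.sum_subset (Finset.subset_univ (Finset.univ.image (Function.update x i)))
    fun z _ hz => ?_).symm.trans ?_
  · have : ¬ ∀ k, k ≠ i → x k = z k := fun h => hz (Finset.mem_image.2 ⟨z i, Finset.mem_univ _, by
      ext k
      by_cases hk : k = i
      · subst hk; simp
      · simp [hk, h k hk]⟩)
    simp [oneQubitOp, this]
  · rw [Finset.sum_image fun a _ b _ h => Function.update_injective x i h]
    refine Finset.sum_congr rfl fun a _ => ?_
    have : ∀ k, k ≠ i → x k = Function.update x i a k := fun k hk => by simp [hk]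
    rw [oneQubitOp, if_pos this, Function.update_self, mul_one]

theorem oneQubitOp_mul_self {m : ℕ} {i : Fin m} {p : Matrix (Fin 2) (Fin 2) ℂ} (hp : p * p = 1) :
    oneQubitOp m i p * oneQubitOp m i p = 1 := by
  ext x y
  rw [oneQubitOp_mul_apply]
  have hoff (a : Fin 2) : (∀ k, k ≠ i → Function.update x i a k = y k) ↔ ∀ k, k ≠ i → x k = y k :=
    forall₂_congr fun k hk => by simp [hk]
  simp only [oneQubitOp, hoff, Function.update_self, ← mul_assoc, ← Finset.sum_mul]
  rw [← Matrix.mul_apply, hp]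
  by_cases hxy : x = y
  · subst hxy
    simp
  · rw [Matrix.one_apply_ne hxy]
    by_cases hi : x i = y i
    · have : ¬ ∀ k, k ≠ i → x k = y k := fun h => hxy (funext fun k => by
        by_cases hk : k = i
        · rw [hk, hi]
        · exact h k hk)
      rw [if_neg this, mul_zero]
    · rw [Matrix.one_apply_ne hi, zero_mul]

theorem oneQubitOp_mul_of_ne {m : ℕ} {i j : Fin m} (hij : i ≠ j) (p q : Matrix (Fin 2) (Fin 2) ℂ) :
    oneQubitOp m i p * oneQubitOp m j q =
      twoQubitOp m i j fun a b c d => p a c * q b d := by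
  ext x y
  have hoff (a : Fin 2) : (∀ k, k ≠ j → Function.update x i a k = y k) ↔
      a = y i ∧ ∀ k, k ≠ i → k ≠ j → x k = y k := by
    constructor
    · exact fun h => ⟨by simpa using h i hij, fun k hi hj => by simpa [hi] using h k hj⟩
    · rintro ⟨rfl, h⟩ k hj
      by_cases hk : k = i
      · subst hk; simp
      · simpa [hk] using h k hk hj
  rw [oneQubitOp_mul_apply, Finset.sum_eq_single (y i)]
  · simp [oneQubitOp, twoQubitOp, hoff, Function.update_of_ne hij.symm]
  · intro a _ ha
    simp [oneQubitOp, hoff, ha]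
  · simp

theorem oneQubitOp_commute {m : ℕ} {i j : Fin m} (hij : i ≠ j) (p q : Matrix (Fin 2) (Fin 2) ℂ) :
    Commute (oneQubitOp m i p) (oneQubitOp m j q) := by
  rw [Commute, SemiconjBy, oneQubitOp_mul_of_ne hij, oneQubitOp_mul_of_ne hij.symm]
  ext x y
  simp only [twoQubitOp, mul_comm (p _ _)]
  congr 2
  exact propext ⟨fun h k hj hi => h k hi hj, fun h k hi hj => h k hj hi⟩

theorem oneQubitOp_conjTranspose (m : ℕ) (i : Fin m) (p : Matrix (Fin 2) (Fin 2) ℂ) :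
    (oneQubitOp m i p)ᴴ = oneQubitOp m i pᴴ := by
  ext x y
  simp only [oneQubitOp, Matrix.conjTranspose_apply, star_mul', eq_comm (a := y _)]
  split_ifs <;> simp

theorem kronecker_mul_prodIso {I J : Type*} [Fintype I] [DecidableEq I] [Fintype J]
    (A : Matrix I I ℂ) (C : Matrix J J ℂ) (v : J → ℂ) :
    (A ⊗ₖ C) * (prodIso v : Matrix (I × J) I ℂ) = (prodIso (C *ᵥ v) : Matrix (I × J) I ℂ) * A := by
  ext ⟨i, t⟩ j
  simp only [Matrix.mul_apply, prodIso, Fintype.sum_prod_type, Matrix.kroneckerMap_apply,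
    Matrix.mulVec, dotProduct, mul_ite, mul_zero, ite_mul, zero_mul]
  rw [Finset.sum_eq_single j]
  · simp [Finset.mul_sum, mul_comm, mul_left_comm]
  · intro k _ hk
    simp [hk]
  · simp

theorem prodIso_conjTranspose_mul_prodIso {I J : Type*} [Fintype I] [DecidableEq I] [Fintype J]
    (v w : J → ℂ) :
    (prodIso v : Matrix (I × J) I ℂ)ᴴ * (prodIso w : Matrix (I × J) I ℂ) = (star v ⬝ᵥ w) • (1 : Matrix I I ℂ) := by
  ext i j
  simp only [Matrix.mul_apply, prodIso, Fintype.sum_prod_type, Matrix.conjTranspose_apply,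
    Matrix.smul_apply, smul_eq_mul, dotProduct]
  rw [Finset.sum_eq_single i]
  · by_cases h : i = j
    · subst h; simp
    · simp [h]
  · intro k _ hk
    simp [hk]
  · simp

/-- The state `|1⟩` of the ancilla qubit. -/
def anc1 : Fin 2 → ℂ := fun t => if t = 1 then 1 else 0

theorem prodIso_anc_sum {I : Type*} [Fintype I] [DecidableEq I] :
    (prodIso anc0 : Matrix (I × Fin 2) I ℂ) * (prodIso anc0 : Matrix (I × Fin 2) I ℂ)ᴴ
      + (prodIso anc1 : Matrix (I × Fin 2) I ℂ) * (prodIso anc1 : Matrix (I × Fin 2) I ℂ)ᴴ = 1 := by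
  ext ⟨i, t⟩ ⟨j, u⟩
  by_cases h : i = j
  · subst h
    fin_cases t <;> fin_cases u <;> simp [Matrix.mul_apply, prodIso, anc0, anc1]
  · simp [Matrix.mul_apply, prodIso, h, Ne.symm h]

theorem Xmat_mulVec_anc0 : Xmat *ᵥ anc0 = anc1 := by
  ext t; fin_cases t <;> simp [Xmat, anc0, anc1, Matrix.mulVec, dotProduct]

theorem Xmat_mulVec_anc1 : Xmat *ᵥ anc1 = anc0 := by
  ext t; fin_cases t <;> simp [Xmat, anc0, anc1, Matrix.mulVec, dotProduct]

theorem proj1_mulVec_anc0 : proj1 *ᵥ anc0 = 0 := by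
  ext t; fin_cases t <;> simp [proj1, anc0, Matrix.mulVec, dotProduct]

theorem proj1_mulVec_anc1 : proj1 *ᵥ anc1 = anc1 := by
  ext t; fin_cases t <;> simp [proj1, anc1, Matrix.mulVec, dotProduct]

theorem prodIso_zero {I J : Type*} [DecidableEq I] :
    (prodIso (0 : J → ℂ) : Matrix (I × J) I ℂ) = 0 := by
  ext p i; simp [prodIso]

/-- Second-order perturbation theory with one ancilla qubit: `Δ |1⟩⟨1| + H + √Δ B ⊗ X` simulates
`H - B²`. -/
theorem isSimulation_of_second_order {I : Type*} [Fintype I] [DecidableEq I] [Nonempty I]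
    {H B : Matrix I I ℂ} (hH : Hᴴ = H) (hB : Bᴴ = B) {l ε η Δ : ℝ} (hl : 1 ≤ l) (hHl : ‖H‖ ≤ l)
    (hBl : ‖B ⊗ₖ Xmat‖ ≤ l) (hε : ε ∈ Set.Ioc (0 : ℝ) 1) (hη : η ∈ Set.Ioc (0 : ℝ) 1)
    (hΔ : 100 * (l ^ 6 / ε ^ 2 + l ^ 2 / η ^ 2) ≤ Δ) :
    IsSimulation ((Δ : ℂ) • ((1 : Matrix I I ℂ) ⊗ₖ proj1) + H ⊗ₖ (1 : Matrix (Fin 2) (Fin 2) ℂ)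
      + ((Real.sqrt Δ : ℝ) : ℂ) • (B ⊗ₖ Xmat)) (H - B * B) anc0 (Δ / 2) η ε := by
  obtain ⟨hε0, hε1⟩ := hε
  obtain ⟨hη0, hη1⟩ := hη
  have hl0 : 0 < l := by linarith
  have h00 : star anc0 ⬝ᵥ anc0 = 1 := by simp [anc0, dotProduct]
  have h11 : star anc1 ⬝ᵥ anc1 = 1 := by simp [anc1, dotProduct]
  have h01 : star anc0 ⬝ᵥ anc1 = 0 := by simp [anc0, anc1, dotProduct]
  have e00 : (prodIso anc0 : Matrix (I × Fin 2) I ℂ)ᴴ * (prodIso anc0 : Matrix (I × Fin 2) I ℂ) = 1 := by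
    rw [prodIso_conjTranspose_mul_prodIso, h00, one_smul]
  have e11 : (prodIso anc1 : Matrix (I × Fin 2) I ℂ)ᴴ * (prodIso anc1 : Matrix (I × Fin 2) I ℂ) = 1 := by
    rw [prodIso_conjTranspose_mul_prodIso, h11, one_smul]
  have e01 : (prodIso anc0 : Matrix (I × Fin 2) I ℂ)ᴴ * (prodIso anc1 : Matrix (I × Fin 2) I ℂ) = 0 := by
    rw [prodIso_conjTranspose_mul_prodIso, h01, zero_smul]
  have hBn : ‖B‖ ≤ l := by
    have h1 : B = (prodIso anc1 : Matrix (I × Fin 2) I ℂ)ᴴ *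
        ((B ⊗ₖ Xmat) * (prodIso anc0 : Matrix (I × Fin 2) I ℂ)) := by
      rw [kronecker_mul_prodIso, Xmat_mulVec_anc0, ← Matrix.mul_assoc, e11, Matrix.one_mul]
    have h2 : ‖(prodIso anc1 : Matrix (I × Fin 2) I ℂ)ᴴ‖ ≤ 1 := by
      rw [Matrix.l2_opNorm_conjTranspose]
      exact l2_opNorm_le_one_of_isometry e11
    rw [h1]
    simpa using l2_opNorm_mul_le_of_le h2
      (l2_opNorm_mul_le_of_le hBl (l2_opNorm_le_one_of_isometry e00))
  have hA : l ^ 2 / η ^ 2 ≤ Δ / 100 := by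
    have : 0 ≤ l ^ 6 / ε ^ 2 := by positivity
    linarith
  have hC : l ^ 6 / ε ^ 2 ≤ Δ / 100 := by
    have : 0 ≤ l ^ 2 / η ^ 2 := by positivity
    linarith
  rw [div_le_iff₀ (by positivity)] at hA hC
  have hΔ0 : 0 < Δ := lt_of_lt_of_le (by positivity) hΔ
  set s := √Δ with hs
  have hss : s ^ 2 = Δ := Real.sq_sqrt hΔ0.le
  have hs0 : 0 < s := Real.sqrt_pos.2 hΔ0
  have hsC : (s : ℂ) ^ 2 = (Δ : ℂ) := by rw [← hss]; push_cast; rfl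
  have hη2 : η ^ 2 ≤ 1 := pow_le_one₀ hη0.le hη1
  have hXH : Xmatᴴ = Xmat := by
    ext i j; fin_cases i <;> fin_cases j <;> simp [Xmat]
  have hpH : proj1ᴴ = proj1 := by
    ext i j; fin_cases i <;> fin_cases j <;> simp [proj1]
  obtain ⟨T, hT1, hT2, hT3, hT4⟩ := exists_isometry_of_blocks (H := H) (B := B) (s := s) (l := l)
    (M := (Δ : ℂ) • ((1 : Matrix I I ℂ) ⊗ₖ proj1) + H ⊗ₖ (1 : Matrix (Fin 2) (Fin 2) ℂ)
      + (s : ℂ) • (B ⊗ₖ Xmat)) e00 e11 e01 prodIso_anc_sum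
    (by simp [Matrix.conjTranspose_kronecker, hH, hB, hXH, hpH]) hH hB
    (by
      simp only [Matrix.add_mul, Matrix.smul_mul, kronecker_mul_prodIso, Xmat_mulVec_anc0,
        proj1_mulVec_anc0, Matrix.one_mulVec, prodIso_zero, Matrix.zero_mul, smul_zero, zero_add])
    (by
      simp only [Matrix.add_mul, Matrix.smul_mul, kronecker_mul_prodIso, Xmat_mulVec_anc1,
        proj1_mulVec_anc1, Matrix.one_mulVec, Matrix.mul_one, hsC]
      abel) hl hHl hBn hs0 (by rw [hss]; nlinarith)
  rw [hss] at hT2 hT3 hT4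
  refine ⟨T, h00, hT1, hT2, hT3.trans ?_, hT4.trans ?_⟩
  · have h1 : l / s ≤ η / 10 := by
      rw [div_le_iff₀ hs0]
      refine le_of_sq_le_sq ?_ (by positivity)
      rw [mul_pow, hss]
      linarith
    have h2 : 4 * l ^ 2 / Δ + 2 * l / s = 4 * (l / s) ^ 2 + 2 * (l / s) := by
      rw [div_pow, hss]; ring
    rw [h2]
    have h3 : 0 ≤ l / s := by positivity
    nlinarith
  · rw [div_le_iff₀ hΔ0]
    have h1 : l ^ 4 ≤ l ^ 6 := pow_le_pow_right₀ hl (by norm_num)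
    have h2 : ε ^ 2 * Δ ≤ ε * Δ := by gcongr; nlinarith
    have h3 : 0 < ε * Δ := mul_pos hε0 hΔ0
    linarith

theorem crossing_identity {A : Type*} [Ring A] [Algebra ℂ A] {a b c d : A} (α β r : ℂ)
    (hr : r * r = 1 / 2) (h : A) (hab : Commute a b) (hac : Commute a c) (had : Commute a d)
    (hbc : Commute b c) (hbd : Commute b d) (hcd : Commute c d)
    (ha : a * a = 1) (hb : b * b = 1) (hc : c * c = 1) (hd : d * d = 1) :
    (h + ((α ^ 2 + β ^ 2 + 2) / 2) • (1 : A) + (α * β) • (a * b) - α • (a * c) - β • (b * d) + c * d)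
      - (r • (-α • a - β • b + c + d)) * (r • (-α • a - β • b + c + d))
      = h + α • (a * d) + β • (b * c) := by
  rw [smul_mul_smul_comm, hr]
  simp only [mul_add, add_mul, mul_sub, sub_mul, smul_mul_assoc, mul_smul_comm, ha, hb, hc, hd,
    ← hab.eq, ← hac.eq, ← had.eq, ← hbc.eq, ← hbd.eq, ← hcd.eq]
  module

end QSim

namespace QSim

/-- crossing gadget.  There is a universal `c₀ > 0` such that for Hermitian
involutions `P_A, P_B, P_C, P_D` on four distinct qubits and reals `α_ad, α_bc`, adjoining one
ancilla `t` and setting `H₀ = |1⟩⟨1|_t`,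
`H₁ = H_else + (α_ad² + α_bc² + 2)/2 + α_ad α_bc P_A P_B − α_ad P_A P_C − α_bc P_B P_D + P_C P_D`,
`H₂ = (−α_ad P_A − α_bc P_B + P_C + P_D)⊗X_t/√2`, the Hamiltonian `H̃ = ΔH₀ + H₁ + √Δ H₂`
is a `(Δ/2, η, ε)`-simulation of the crossed Hamiltonian
`H_else + α_ad P_A P_D + α_bc P_B P_C` (product encoding, ancilla state `|0⟩_t`) whenever
`ε, η ∈ (0,1]` and `Δ ≥ c₀(Λ⁶/ε² + Λ²/η²)`, `Λ = max(‖H₁‖, ‖H₂‖, 1)`. -/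
theorem crossing_gadget :
    ∃ c₀ : ℝ, 0 < c₀ ∧
    ∀ (m : ℕ) (Helse : QOp m), Helseᴴ = Helse →
    ∀ (qA qB qC qD : Fin m),
      qA ≠ qB → qA ≠ qC → qA ≠ qD → qB ≠ qC → qB ≠ qD → qC ≠ qD →
    ∀ (pA pB pC pD : Matrix (Fin 2) (Fin 2) ℂ),
      pAᴴ = pA → pBᴴ = pB → pCᴴ = pC → pDᴴ = pD →
      pA * pA = 1 → pB * pB = 1 → pC * pC = 1 → pD * pD = 1 →
    ∀ (αad αbc : ℝ),
    let PA : QOp m := oneQubitOp m qA pA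
    let PB : QOp m := oneQubitOp m qB pB
    let PC : QOp m := oneQubitOp m qC pC
    let PD : QOp m := oneQubitOp m qD pD
    let H₁ : QOp m := Helse + (((αad ^ 2 + αbc ^ 2 + 2) / 2 : ℝ) : ℂ) • (1 : QOp m)
      + ((αad * αbc : ℝ) : ℂ) • (PA * PB) - (αad : ℂ) • (PA * PC)
      - (αbc : ℂ) • (PB * PD) + PC * PD
    let H₂ : Matrix (QIdx m × Fin 2) (QIdx m × Fin 2) ℂ :=
      (((Real.sqrt 2)⁻¹ : ℝ) : ℂ) •
        ((-(αad : ℂ) • PA - (αbc : ℂ) • PB + PC + PD) ⊗ₖ Xmat)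
    let Λ : ℝ := max (opNorm H₁) (max (opNorm H₂) 1)
    ∀ ε η : ℝ, ε ∈ Set.Ioc (0 : ℝ) 1 → η ∈ Set.Ioc (0 : ℝ) 1 →
      ∀ Δ : ℝ, c₀ * (Λ ^ 6 / ε ^ 2 + Λ ^ 2 / η ^ 2) ≤ Δ →
        IsSimulation
          ((Δ : ℂ) • ((1 : QOp m) ⊗ₖ proj1) + H₁ ⊗ₖ (1 : Matrix (Fin 2) (Fin 2) ℂ)
            + ((Real.sqrt Δ : ℝ) : ℂ) • H₂)
          (Helse + (αad : ℂ) • (PA * PD) + (αbc : ℂ) • (PB * PC)) anc0 (Δ / 2) η ε := by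
  refine ⟨100, by norm_num, ?_⟩
  intro m Helse hHelse qA qB qC qD hAB hAC hAD hBC hBD hCD pA pB pC pD hpA hpB hpC hpD
    hA2 hB2 hC2 hD2 αad αbc PA PB PC PD H₁ H₂ Λ ε η hε hη Δ hΔ
  have cAB : Commute PA PB := oneQubitOp_commute hAB pA pB
  have cAC : Commute PA PC := oneQubitOp_commute hAC pA pC
  have cAD : Commute PA PD := oneQubitOp_commute hAD pA pD
  have cBC : Commute PB PC := oneQubitOp_commute hBC pB pC
  have cBD : Commute PB PD := oneQubitOp_commute hBD pB pD
  have cCD : Commute PC PD := oneQubitOp_commute hCD pC pD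
  have hPA : PAᴴ = PA := by rw [oneQubitOp_conjTranspose, hpA]
  have hPB : PBᴴ = PB := by rw [oneQubitOp_conjTranspose, hpB]
  have hPC : PCᴴ = PC := by rw [oneQubitOp_conjTranspose, hpC]
  have hPD : PDᴴ = PD := by rw [oneQubitOp_conjTranspose, hpD]
  have hr : (((Real.sqrt 2)⁻¹ : ℝ) : ℂ) * (((Real.sqrt 2)⁻¹ : ℝ) : ℂ) = 1 / 2 := by
    rw [← Complex.ofReal_mul, ← mul_inv, Real.mul_self_sqrt (by norm_num)]
    norm_num
  set B : QOp m := (((Real.sqrt 2)⁻¹ : ℝ) : ℂ) •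
    (-(αad : ℂ) • PA - (αbc : ℂ) • PB + PC + PD) with hBdef
  have hH₂ : H₂ = B ⊗ₖ Xmat := (Matrix.smul_kronecker _ _ _).symm
  have hH₁ : H₁ᴴ = H₁ := by
    simp only [H₁, Matrix.conjTranspose_add, Matrix.conjTranspose_sub, Matrix.conjTranspose_smul,
      Matrix.conjTranspose_mul, Matrix.conjTranspose_one, hHelse, hPA, hPB, hPC, hPD,
      RCLike.star_def, Complex.conj_ofReal, ← cAB.eq, ← cAC.eq, ← cBD.eq, ← cCD.eq]
  have hB : Bᴴ = B := by
    simp only [hBdef, Matrix.conjTranspose_add, Matrix.conjTranspose_sub,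
      Matrix.conjTranspose_smul, hPA, hPB, hPC, hPD, RCLike.star_def, map_neg,
      Complex.conj_ofReal]
  have htarget : H₁ - B * B = Helse + (αad : ℂ) • (PA * PD) + (αbc : ℂ) • (PB * PC) := by
    rw [← crossing_identity (αad : ℂ) (αbc : ℂ) _ hr Helse cAB cAC cAD cBC cBD cCD
      (oneQubitOp_mul_self hA2) (oneQubitOp_mul_self hB2) (oneQubitOp_mul_self hC2)
      (oneQubitOp_mul_self hD2)]
    simp only [H₁, hBdef]
    push_cast
    rfl
  rw [← htarget, hH₂]
  exact isSimulation_of_second_order hH₁ hB ((le_max_right _ _).trans (le_max_right _ _))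
    (le_max_left _ _) (hH₂ ▸ (le_max_left _ _).trans (le_max_right _ _)) hε hη hΔ

end QSim
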